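/- (Safe multiple-team slot.) Let A be an input for the team power game with n teams and m time slots. Suppose there exists a time slot j* such that for every team i and every time slot j ≠ j* it holds that A i j ≤ ∑_{i' ≠ i} A i' j*. Then the strategy profile B defined by B i j* = A i j* for every team i and B i j = 0 for every team i and every time slot j ≠ j* is a 1-strong Nash equilibrium for A; in particular, A admits a 1-strong Nash equilibrium. -/

import Mathlib

open Finset

section TPG

variable {T C : Type*} [Fintype T] [Fintype C] [DecidableEq T] [DecidableEq C]

/-- Sum of declared availabilities at a time slot. -/
def colSum (B : T → C → ℕ) (j : C) : ℕ := ∑ i, B i j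

/-- Winning time slots: those maximizing the column sum. -/
def winners (B : T → C → ℕ) : Finset C :=
  Finset.univ.filter fun j => ∀ j', colSum B j' ≤ colSum B j

/-- Relative power of team `i` at slot `j` (0 when the denominator is 0). -/
def power (B : T → C → ℕ) (i : T) (j : C) : ℚ :=
  (B i j : ℚ) / (colSum B j : ℚ)

/-- Pay-off of team `i`: minimum relative power over all winning slots. -/
def payoff (B : T → C → ℕ) (i : T) : ℚ :=
  if h : (winners B).Nonempty then (winners B).inf' h (power B i) else 0

/-- `B` is a strategy profile for input `A`. -/
def IsProfile (A B : T → C → ℕ) : Prop := ∀ i j, B i j ≤ A i j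

/-- `D` is an improvement step for coalition `S` with respect to `B` (for input `A`). -/
def IsImprovement (A B : T → C → ℕ) (S : Finset T) (D : T → C → ℕ) : Prop :=
  IsProfile A D ∧ (∀ i ∉ S, ∀ j, D i j = B i j) ∧ ∀ i ∈ S, payoff B i < payoff D i

/-- `B` is a `t`-strong Nash equilibrium for `A`. -/
def IsStrongNash (t : ℕ) (A B : T → C → ℕ) : Prop :=
  IsProfile A B ∧
    ∀ S : Finset T, S.Nonempty → S.card ≤ t → ∀ D, ¬ IsImprovement A B S D

end TPG

section TPG

variable {T C : Type*}

theorem mem_winners [Fintype T] [Fintype C] {B : T → C → ℕ} {j : C} :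
    j ∈ winners B ↔ ∀ j', colSum B j' ≤ colSum B j := by
  simp [winners]

theorem payoff_le_power [Fintype T] [Fintype C] {B : T → C → ℕ} {j : C}
    (hj : j ∈ winners B) (i : T) :
    payoff B i ≤ power B i j := by
  rw [payoff, dif_pos ⟨j, hj⟩]
  exact Finset.inf'_le _ hj

theorem le_payoff [Fintype T] [Fintype C] {B : T → C → ℕ} (hB : (winners B).Nonempty)
    {i : T} {q : ℚ}
    (hq : ∀ j ∈ winners B, q ≤ power B i j) : q ≤ payoff B i := by
  rw [payoff, dif_pos hB]
  exact Finset.le_inf' _ _ hq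

theorem colSum_eq_add_sum_erase [Fintype T] [DecidableEq T] (B : T → C → ℕ) (i : T) (j : C) :
    colSum B j = B i j + ∑ i' ∈ Finset.univ.erase i, B i' j :=
  (Finset.add_sum_erase _ _ (Finset.mem_univ i)).symm

theorem div_add_le_div_add {d a : ℕ} (hda : d ≤ a) (r : ℕ) :
    (d : ℚ) / ((d + r : ℕ) : ℚ) ≤ (a : ℚ) / ((a + r : ℕ) : ℚ) := by
  rcases Nat.eq_zero_or_pos d with rfl | hd
  · simp only [Nat.cast_zero, zero_div]
    positivity
  · rw [div_le_div_iff₀ (by positivity) (by have := hd.trans_le hda; positivity)]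
    norm_cast
    nlinarith

/-- The profile in which every team declares its true availability at `jstar`
and zero elsewhere. -/
def concentrate [DecidableEq C] (A : T → C → ℕ) (jstar : C) : T → C → ℕ :=
  fun i j => if j = jstar then A i jstar else 0

theorem colSum_concentrate_of_ne [Fintype T] [DecidableEq C] (A : T → C → ℕ) {jstar j : C}
    (hj : j ≠ jstar) :
    colSum (concentrate A jstar) j = 0 := by
  simp [colSum, concentrate, hj]

theorem isProfile_concentrate [DecidableEq C] (A : T → C → ℕ) (jstar : C) :
    IsProfile A (concentrate A jstar) := by
  intro i j
  by_cases hj : j = jstar <;> simp [concentrate, hj]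

theorem mem_winners_concentrate [Fintype T] [Fintype C] [DecidableEq C]
    (A : T → C → ℕ) (jstar : C) :
    jstar ∈ winners (concentrate A jstar) := by
  rw [mem_winners]
  intro j
  by_cases hj : j = jstar
  · rw [hj]
  · simp [colSum_concentrate_of_ne A hj]

theorem payoff_le_payoff_concentrate [Fintype T] [Fintype C] [DecidableEq T] [DecidableEq C]
    {A D : T → C → ℕ} {jstar : C} {i : T}
    (h : ∀ j, j ≠ jstar → A i j ≤ ∑ i' ∈ Finset.univ.erase i, A i' jstar)
    (hD : IsProfile A D) (hDi : ∀ i', i' ≠ i → ∀ j, D i' j = concentrate A jstar i' j) :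
    payoff D i ≤ payoff (concentrate A jstar) i := by
  have hsum (j : C) : colSum D j =
      D i j + ∑ i' ∈ Finset.univ.erase i, concentrate A jstar i' j := by
    rw [colSum_eq_add_sum_erase D i]
    congr 1
    exact Finset.sum_congr rfl fun i' hi' => hDi i' (Finset.ne_of_mem_erase hi') j
  have hstar : colSum D jstar = D i jstar + ∑ i' ∈ Finset.univ.erase i, A i' jstar := by
    simp [hsum, concentrate]
  have hstar' : colSum (concentrate A jstar) jstar =
      A i jstar + ∑ i' ∈ Finset.univ.erase i, A i' jstar := by
    rw [colSum_eq_add_sum_erase _ i]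
    simp [concentrate]
  have hwin : jstar ∈ winners D := by
    rw [mem_winners]
    intro j
    by_cases hj : j = jstar
    · rw [hj]
    · have hcol : colSum D j = D i j := by simp [hsum, concentrate, hj]
      have := hD i j
      have := h j hj
      omega
  refine (payoff_le_power hwin i).trans (le_payoff ⟨jstar, mem_winners_concentrate A jstar⟩ ?_)
  intro j hj
  by_cases hjs : j = jstar
  · subst hjs
    rw [power, power, hstar, hstar']
    simp only [concentrate, if_true]
    exact div_add_le_div_add (hD i j) _
  · have hle := mem_winners.mp hj jstar
    rw [colSum_concentrate_of_ne A hjs, hstar'] at hle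
    have hzero : D i jstar = 0 := by
      have := hD i jstar
      omega
    simp [power, hzero, concentrate, hjs]

theorem isStrongNash_one_concentrate [Fintype T] [Fintype C] [DecidableEq T] [DecidableEq C]
    {A : T → C → ℕ} {jstar : C}
    (h : ∀ i, ∀ j, j ≠ jstar → A i j ≤ ∑ i' ∈ Finset.univ.erase i, A i' jstar) :
    IsStrongNash 1 A (concentrate A jstar) := by
  refine ⟨isProfile_concentrate A jstar, ?_⟩
  rintro S hS hcard D ⟨hD, hDS, hlt⟩
  obtain ⟨i, rfl⟩ := Finset.card_eq_one.mp (hcard.antisymm hS.card_pos)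
  exact (hlt i (Finset.mem_singleton_self i)).not_ge
    (payoff_le_payoff_concentrate (h i) hD fun i' hi' => hDS i' (by simpa using hi'))

end TPG

/-- Safe multiple-team slot: if `j*` is a slot such that no single team's availability
at any other slot exceeds the total availability of the remaining teams at `j*`, then
the profile where every team declares its true availability at `j*` and zero elsewhere
is a 1-strong Nash equilibrium; in particular `A` admits a 1-strong Nash equilibrium. -/
theorem safe_multiple_team_slot {n m : ℕ} (A : Fin n → Fin m → ℕ) (jstar : Fin m)
    (h : ∀ i : Fin n, ∀ j, j ≠ jstar →
      A i j ≤ ∑ i' ∈ Finset.univ.erase i, A i' jstar) :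
    IsStrongNash 1 A (fun i j => if j = jstar then A i jstar else 0) ∧
    ∃ B : Fin n → Fin m → ℕ, IsStrongNash 1 A B := by
  exact ⟨isStrongNash_one_concentrate h, _, isStrongNash_one_concentrate h⟩
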